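/- arXiv:1708.09034 — 7 statements merged into one kernel-verified Lean document; each statement's English description precedes it below -/
import Mathlib

section
/- Suppose that for every complex number λ, the (n + n_y) × (n + n_f) block matrix [[Φ − λI, Ẽ], [CΦ^τ, H]] has rank n + n_f (i.e., the fault subsystem (Φ, Ẽ, CΦ^τ, H) has no invariant zeros and H has full column rank). Then for every complex number λ, the (n + n_y) × n stacked matrix [[Φ₁ − λI], [C₂]] has rank n, i.e., the pair (Φ₁, C₂) is observable in the sense of the PBH test. -/
theorem Matrix.rank_eq_card_iff_forall_mulVec_eq_zero {m n K : Type*} [Fintype n] [Field K]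
    (M : Matrix m n K) :
    M.rank = Fintype.card n ↔ ∀ v : n → K, M.mulVec v = 0 → v = 0 := by
  have h := M.mulVecLin.finrank_range_add_finrank_ker
  rw [Module.finrank_fintype_fun_eq_card] at h
  rw [Matrix.rank, ← Matrix.ker_mulVecLin_eq_bot_iff, ← Submodule.finrank_eq_zero]
  omega


/-- Theorem 1 (observability half): if the fault subsystem `(Φ, Ẽ, CΦ^τ, H)` has no
invariant zeros (PBH-type full column rank of the system matrix for every `λ`), then the
pair `(Φ₁, C₂)` of the closed-loop left inverse is observable in the PBH sense. -/
theorem stmt0 (n nf ny : ℕ) (τ : ℕ)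
    (Φ : Matrix (Fin n) (Fin n) ℂ) (E : Matrix (Fin n) (Fin nf) ℂ)
    (C : Matrix (Fin ny) (Fin n) ℂ) (H : Matrix (Fin ny) (Fin nf) ℂ)
    (Pm : Matrix (Fin nf) (Fin ny) ℂ)
    (hPm : Pm * H = 1)
    (hzeros : ∀ l : ℂ,
      (Matrix.fromBlocks (Φ - l • (1 : Matrix (Fin n) (Fin n) ℂ)) E (C * Φ ^ τ) H).rank
        = n + nf) :
    ∀ l : ℂ,
      (Matrix.fromRows
        ((Φ - E * Pm * C * Φ ^ τ) - l • (1 : Matrix (Fin n) (Fin n) ℂ))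
        (((1 : Matrix (Fin ny) (Fin ny) ℂ) - H * Pm) * C * Φ ^ τ)).rank = n := by
  intro l
  have hker := (Matrix.rank_eq_card_iff_forall_mulVec_eq_zero _).1
    ((hzeros l).trans (by simp))
  refine Eq.trans ((Matrix.rank_eq_card_iff_forall_mulVec_eq_zero _).2 fun v hv => ?_)
    (Fintype.card_fin n)
  rw [Matrix.fromRows_mulVec] at hv
  have h₁ := congrArg (· ∘ Sum.inl) hv
  have h₂ := congrArg (· ∘ Sum.inr) hv
  simp only [Sum.elim_comp_inl, Sum.elim_comp_inr] at h₁ h₂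
  have hw := hker (Sum.elim v (-((Pm * C * Φ ^ τ).mulVec v))) <| by
    rw [Matrix.fromBlocks_mulVec, Sum.elim_comp_inl, Sum.elim_comp_inr, ← Sum.elim_zero_zero]
    congr 1
    · refine Eq.trans ?_ h₁
      simp only [Matrix.sub_mulVec, Matrix.mulVec_neg, Matrix.mulVec_mulVec, Matrix.mul_assoc]
      abel
    · refine Eq.trans ?_ h₂
      simp only [Matrix.sub_mul, Matrix.one_mul, Matrix.sub_mulVec, Matrix.mulVec_neg,
        Matrix.mulVec_mulVec, Matrix.mul_assoc]
      abel
  exact congrArg (· ∘ Sum.inl) hw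
end

section
/- For every complex number λ, the block matrix factorization [[Φ₁ − λI, Ẽ], [C₂, H]] = [[Φ − λI, Ẽ], [CΦ^τ, H]] · [[I, 0], [−ΠCΦ^τ, I]] holds, where the right factor is a block lower-triangular (hence invertible) matrix. Consequently rank [[Φ₁ − λI, Ẽ], [C₂, H]] = rank [[Φ − λI, Ẽ], [CΦ^τ, H]] for every λ. -/
/-- The key block-matrix factorization in the proof of Theorem 1:
`[[Φ₁ − λI, Ẽ], [C₂, H]] = [[Φ − λI, Ẽ], [CΦ^τ, H]] · [[I, 0], [−ΠCΦ^τ, I]]`,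
and consequently the two system matrices have equal rank for every `λ`. -/
theorem stmt2 (n nf ny : ℕ) (τ : ℕ)
    (Φ : Matrix (Fin n) (Fin n) ℂ) (E : Matrix (Fin n) (Fin nf) ℂ)
    (C : Matrix (Fin ny) (Fin n) ℂ) (H : Matrix (Fin ny) (Fin nf) ℂ)
    (Pm : Matrix (Fin nf) (Fin ny) ℂ) :
    ∀ l : ℂ,
      (Matrix.fromBlocks
          ((Φ - E * Pm * C * Φ ^ τ) - l • (1 : Matrix (Fin n) (Fin n) ℂ)) E
          (((1 : Matrix (Fin ny) (Fin ny) ℂ) - H * Pm) * C * Φ ^ τ) H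
        = Matrix.fromBlocks (Φ - l • (1 : Matrix (Fin n) (Fin n) ℂ)) E (C * Φ ^ τ) H
            * Matrix.fromBlocks (1 : Matrix (Fin n) (Fin n) ℂ) 0
                (-(Pm * C * Φ ^ τ)) (1 : Matrix (Fin nf) (Fin nf) ℂ))
      ∧ (Matrix.fromBlocks
          ((Φ - E * Pm * C * Φ ^ τ) - l • (1 : Matrix (Fin n) (Fin n) ℂ)) E
          (((1 : Matrix (Fin ny) (Fin ny) ℂ) - H * Pm) * C * Φ ^ τ) H).rank
        = (Matrix.fromBlocks (Φ - l • (1 : Matrix (Fin n) (Fin n) ℂ)) E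
            (C * Φ ^ τ) H).rank := by
  intro l
  have factorization :
      Matrix.fromBlocks
          ((Φ - E * Pm * C * Φ ^ τ) - l • (1 : Matrix (Fin n) (Fin n) ℂ)) E
          (((1 : Matrix (Fin ny) (Fin ny) ℂ) - H * Pm) * C * Φ ^ τ) H
        = Matrix.fromBlocks (Φ - l • (1 : Matrix (Fin n) (Fin n) ℂ)) E (C * Φ ^ τ) H
            * Matrix.fromBlocks (1 : Matrix (Fin n) (Fin n) ℂ) 0
                (-(Pm * C * Φ ^ τ)) (1 : Matrix (Fin nf) (Fin nf) ℂ) := by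
    rw [Matrix.fromBlocks_multiply]
    congr 1
    · simp only [Matrix.mul_one, Matrix.mul_neg, Matrix.mul_assoc]
      abel
    · simp
    · simp only [Matrix.mul_one, Matrix.mul_neg, Matrix.mul_assoc, Matrix.sub_mul,
        Matrix.one_mul]
      abel
    · simp
  refine ⟨factorization, ?_⟩
  rw [factorization]
  exact Matrix.rank_mul_eq_left_of_isUnit_det _ _ (by simp)
end

section
/- Define the Markov parameter sequences: K_0 = D₁ and K_i = C₁(Φ₁ − K_r C₂)^{i−1}(B₁ + K_r D₂) for i ≥ 1; G_0 = D₁ and G_i = C₁Φ₁^{i−1}B₁ for i ≥ 1; J_0 = D₂ and J_i = −C₂Φ₁^{i−1}B₁ for i ≥ 1; M_0 = 0 and M_i = C₁(Φ₁ − K_r C₂)^{i−1}K_r for i ≥ 1. Then for every i ≥ 0, K_i = G_i + Σ_{j=0}^{i} M_{i−j} J_j. (Equivalently, the block-Toeplitz matrices satisfy 𝒦_L = 𝒢_L + ℳ_L 𝒥_L: the closed-loop left inverse equals the open-loop left inverse plus the feedback dynamics acting on the residual reconstruction error map.) -/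
/-- Expansion of a power of a perturbed element in a noncommutative ring. -/
theorem sub_pow_eq_pow_sub_sum {R : Type*} [Ring R] (a b : R) (i : ℕ) :
    (a - b) ^ i = a ^ i - ∑ j ∈ Finset.range i, (a - b) ^ (i - 1 - j) * b * a ^ j := by
  induction i with
  | zero => simp
  | succ i ih =>
    have hsum : ∑ j ∈ Finset.range i, (a - b) ^ (i + 1 - 1 - j) * b * a ^ j =
        (a - b) * ∑ j ∈ Finset.range i, (a - b) ^ (i - 1 - j) * b * a ^ j := by
      rw [Finset.mul_sum]
      refine Finset.sum_congr rfl fun j hj => ?_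
      have hij : i + 1 - 1 - j = (i - 1 - j) + 1 := by
        have := Finset.mem_range.mp hj
        omega
      rw [hij, pow_succ']
      simp only [mul_assoc]
    rw [Finset.sum_range_succ, hsum, pow_succ' (a - b) i]
    rw [ih]
    simp only [add_tsub_cancel_right, tsub_self, pow_zero, one_mul, pow_succ' a i, mul_sub,
      sub_mul]
    abel


/-- The Markov-parameter identity `𝒦_L = 𝒢_L + ℳ_L 𝒥_L` from the Appendix:
`K_i = G_i + Σ_{j=0}^{i} M_{i−j} J_j` for every `i ≥ 0`. -/
theorem stmt3 (n nf ny : ℕ)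
    (Φ₁ : Matrix (Fin n) (Fin n) ℝ) (B₁ Kr : Matrix (Fin n) (Fin ny) ℝ)
    (C₁ : Matrix (Fin nf) (Fin n) ℝ) (D₁ : Matrix (Fin nf) (Fin ny) ℝ)
    (C₂ : Matrix (Fin ny) (Fin n) ℝ) (D₂ : Matrix (Fin ny) (Fin ny) ℝ)
    (K G M : ℕ → Matrix (Fin nf) (Fin ny) ℝ) (J : ℕ → Matrix (Fin ny) (Fin ny) ℝ)
    (hK0 : K 0 = D₁)
    (hK : ∀ i : ℕ, K (i + 1) = C₁ * (Φ₁ - Kr * C₂) ^ i * (B₁ + Kr * D₂))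
    (hG0 : G 0 = D₁)
    (hG : ∀ i : ℕ, G (i + 1) = C₁ * Φ₁ ^ i * B₁)
    (hJ0 : J 0 = D₂)
    (hJ : ∀ i : ℕ, J (i + 1) = -(C₂ * Φ₁ ^ i * B₁))
    (hM0 : M 0 = 0)
    (hM : ∀ i : ℕ, M (i + 1) = C₁ * (Φ₁ - Kr * C₂) ^ i * Kr) :
    ∀ i : ℕ, K i = G i + ∑ j ∈ Finset.range (i + 1), M (i - j) * J j := by
  rintro (_ | i)
  · simp [hK0, hG0, hM0]
  · have hsum : ∑ j ∈ Finset.range i, M (i - j) * J (j + 1) =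
        -(C₁ * (∑ j ∈ Finset.range i,
          (Φ₁ - Kr * C₂) ^ (i - 1 - j) * (Kr * C₂) * Φ₁ ^ j) * B₁) := by
      rw [Matrix.mul_sum, Matrix.sum_mul, ← Finset.sum_neg_distrib]
      refine Finset.sum_congr rfl fun j hj => ?_
      have hij : i - j = (i - 1 - j) + 1 := by
        have := Finset.mem_range.mp hj
        omega
      rw [hij, hM, hJ]
      simp only [Matrix.mul_neg, Matrix.mul_assoc]
    rw [Finset.sum_range_succ', Finset.sum_range_succ]
    simp only [Nat.add_sub_add_right, tsub_self, tsub_zero, hM0, Matrix.zero_mul, add_zero]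
    rw [hsum, hK, hG, hM, hJ0, Matrix.mul_add, ← Matrix.mul_assoc _ Kr D₂, ← add_assoc]
    congr 1
    rw [← sub_eq_add_neg, ← Matrix.sub_mul, ← Matrix.mul_sub, ← sub_pow_eq_pow_sub_sum]
end

section
/- Define the Markov parameter sequences ℋ_0 = H, ℋ_i = CΦ^{τ+i−1}Ẽ for i ≥ 1, and G_0 = Π, G_i = −ΠCΦ^τ Φ₁^{i−1} ẼΠ for i ≥ 1 (the Markov parameters of the open-loop left inverse (Φ₁, B₁, C₁, D₁) with B₁ = ẼΠ, C₁ = −ΠCΦ^τ, D₁ = Π). Then Σ_{j=0}^{i} G_{i−j} ℋ_j = I_{n_f} if i = 0 and Σ_{j=0}^{i} G_{i−j} ℋ_j = 0 for every i ≥ 1; that is, the state-space open-loop left inverse exactly inverts the fault subsystem at the level of Markov parameters. -/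
/-- Noncommutative telescoping identity for the difference of two powers. -/
theorem sum_range_pow_mul_sub_mul_pow {R : Type*} [Ring R] (a b : R) (k : ℕ) :
    ∑ l ∈ Finset.range k, a ^ (k - 1 - l) * (b - a) * b ^ l = b ^ k - a ^ k := by
  have h := Finset.sum_range_sub (fun l => a ^ (k - l) * b ^ l) k
  simp only [Nat.sub_self, pow_zero, one_mul, Nat.sub_zero, mul_one] at h
  rw [← h]
  refine Finset.sum_congr rfl fun l hl => ?_
  have hlk := Finset.mem_range.mp hl
  rw [show k - (l + 1) = k - 1 - l by lia, show k - l = k - 1 - l + 1 by lia,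
    pow_succ a, pow_succ' b]
  noncomm_ring


/-- State-space form of `𝒢_L 𝒯_L^f = I`: the Markov parameters of the open-loop
left inverse `(Φ₁, ẼΠ, −ΠCΦ^τ, Π)` exactly invert the fault-subsystem Markov
parameters at the level of convolution. -/
theorem stmt7 (n nf ny : ℕ) (τ : ℕ)
    (Φ : Matrix (Fin n) (Fin n) ℝ) (E : Matrix (Fin n) (Fin nf) ℝ)
    (C : Matrix (Fin ny) (Fin n) ℝ) (H : Matrix (Fin ny) (Fin nf) ℝ)
    (Pm : Matrix (Fin nf) (Fin ny) ℝ)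
    (hPm : Pm * H = 1)
    (ℋ : ℕ → Matrix (Fin ny) (Fin nf) ℝ)
    (G : ℕ → Matrix (Fin nf) (Fin ny) ℝ)
    (hℋ0 : ℋ 0 = H)
    (hℋ : ∀ i : ℕ, ℋ (i + 1) = C * Φ ^ (τ + i) * E)
    (hG0 : G 0 = Pm)
    (hG : ∀ i : ℕ, G (i + 1)
      = -(Pm * C * Φ ^ τ * (Φ - E * Pm * C * Φ ^ τ) ^ i * (E * Pm))) :
    ∀ i : ℕ, ∑ j ∈ Finset.range (i + 1), G (i - j) * ℋ j
      = if i = 0 then (1 : Matrix (Fin nf) (Fin nf) ℝ) else 0 := by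
  intro i
  rcases i with _ | k
  · simp [hG0, hℋ0, hPm]
  set K := Pm * C * Φ ^ τ with hK
  set A := Φ - E * Pm * C * Φ ^ τ with hA
  have hEK : E * K = Φ - A := by simp [hK, hA, Matrix.mul_assoc]
  have hfirst : G (k + 1 - 0) * ℋ 0 = -(K * A ^ k * E) := by
    rw [Nat.sub_zero, hG, hℋ0, Matrix.neg_mul, Matrix.mul_assoc _ (E * Pm), Matrix.mul_assoc E,
      hPm, Matrix.mul_one]
  have hlast : G (k + 1 - (k + 1)) * ℋ (k + 1) = K * Φ ^ k * E := by
    rw [Nat.sub_self, hG0, hℋ, pow_add, hK]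
    simp only [Matrix.mul_assoc]
  have hmid : ∀ l ∈ Finset.range k, G (k + 1 - (l + 1)) * ℋ (l + 1)
      = -(K * (A ^ (k - 1 - l) * (Φ - A) * Φ ^ l) * E) := by
    intro l hl
    have hlk := Finset.mem_range.mp hl
    rw [show k + 1 - (l + 1) = k - 1 - l + 1 by lia, hG, hℋ, pow_add, ← hEK, hK]
    simp only [Matrix.mul_assoc, Matrix.neg_mul]
  rw [Finset.sum_range_succ, Finset.sum_range_succ', Finset.sum_congr rfl hmid, hfirst, hlast,
    Finset.sum_neg_distrib, ← Matrix.sum_mul, ← Matrix.mul_sum, sum_range_pow_mul_sub_mul_pow,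
    Matrix.mul_sub, Matrix.sub_mul, if_neg k.succ_ne_zero]
  abel
end

section
/- Define ℋ_0 = H, ℋ_i = CΦ^{τ+i−1}Ẽ for i ≥ 1, and G_0 = Π, G_i = −ΠCΦ^τ Φ₁^{i−1} ẼΠ for i ≥ 1. Then the Markov parameters of the residual-reconstruction-error system (Φ₁, B₁, −C₂, D₂), with B₁ = ẼΠ, C₂ = (I − HΠ)CΦ^τ, D₂ = I − HΠ, satisfy: I − ℋ_0 G_0 = D₂, and −Σ_{j=0}^{i} ℋ_{i−j} G_j = −C₂Φ₁^{i−1}B₁ for every i ≥ 1. (Equivalently, as block-Toeplitz matrices, 𝒥_L = I − 𝒯_L^f 𝒢_L = 𝒯_L(Φ₁, B₁, −C₂, D₂).) -/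
/-- The telescoping expansion of `a ^ m - b ^ m` in a noncommutative ring. -/
theorem sum_pow_mul_sub_mul_pow {R : Type*} [Ring R] (a b : R) (m : ℕ) :
    ∑ k ∈ Finset.range m, a ^ (m - 1 - k) * (a - b) * b ^ k = a ^ m - b ^ m := by
  induction m with
  | zero => simp
  | succ m ih =>
    have h : ∑ k ∈ Finset.range m, a ^ (m + 1 - 1 - k) * (a - b) * b ^ k
        = a * ∑ k ∈ Finset.range m, a ^ (m - 1 - k) * (a - b) * b ^ k := by
      rw [Finset.mul_sum]
      refine Finset.sum_congr rfl fun k hk => ?_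
      have hk' := Finset.mem_range.mp hk
      rw [show m + 1 - 1 - k = (m - 1 - k) + 1 by omega, pow_succ']
      simp only [mul_assoc]
    rw [Finset.sum_range_succ, h, ih]
    simp only [Nat.add_sub_cancel, Nat.sub_self, pow_zero, one_mul, pow_succ', mul_sub, sub_mul]
    abel


/-- Equation (20c) of the paper: `𝒥_L = I − 𝒯_L^f 𝒢_L` equals the block-Toeplitz
matrix of the residual-reconstruction-error system `(Φ₁, B₁, −C₂, D₂)`, at the level
of Markov parameters. -/
theorem stmt8 (n nf ny : ℕ) (τ : ℕ)
    (Φ : Matrix (Fin n) (Fin n) ℝ) (E : Matrix (Fin n) (Fin nf) ℝ)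
    (C : Matrix (Fin ny) (Fin n) ℝ) (H : Matrix (Fin ny) (Fin nf) ℝ)
    (Pm : Matrix (Fin nf) (Fin ny) ℝ)
    (hPm : Pm * H = 1)
    (ℋ : ℕ → Matrix (Fin ny) (Fin nf) ℝ)
    (G : ℕ → Matrix (Fin nf) (Fin ny) ℝ)
    (hℋ0 : ℋ 0 = H)
    (hℋ : ∀ i : ℕ, ℋ (i + 1) = C * Φ ^ (τ + i) * E)
    (hG0 : G 0 = Pm)
    (hG : ∀ i : ℕ, G (i + 1)
      = -(Pm * C * Φ ^ τ * (Φ - E * Pm * C * Φ ^ τ) ^ i * (E * Pm))) :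
    ((1 : Matrix (Fin ny) (Fin ny) ℝ) - ℋ 0 * G 0
        = 1 - H * Pm)
      ∧ ∀ i : ℕ, -(∑ j ∈ Finset.range (i + 2), ℋ (i + 1 - j) * G j)
          = -(((1 : Matrix (Fin ny) (Fin ny) ℝ) - H * Pm) * C * Φ ^ τ
              * (Φ - E * Pm * C * Φ ^ τ) ^ i * (E * Pm)) := by
  refine ⟨by rw [hℋ0, hG0], fun i => congrArg Neg.neg ?_⟩
  set Ψ := Φ - E * Pm * C * Φ ^ τ with hΨ
  have hgain : Φ - Ψ = E * Pm * C * Φ ^ τ := by rw [hΨ, sub_sub_cancel]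
  have hmid : ∑ k ∈ Finset.range i, ℋ (i + 1 - (k + 1)) * G (k + 1)
      = -(C * Φ ^ τ * (Φ ^ i - Ψ ^ i) * (E * Pm)) := by
    rw [← sum_pow_mul_sub_mul_pow, hgain, Matrix.mul_sum, Matrix.sum_mul,
      ← Finset.sum_neg_distrib]
    refine Finset.sum_congr rfl fun k hk => ?_
    have hk' := Finset.mem_range.mp hk
    rw [show i + 1 - (k + 1) = (i - 1 - k) + 1 by omega, hℋ, hG, pow_add]
    simp only [Matrix.mul_assoc, Matrix.mul_neg]
  rw [Finset.sum_range_succ', Finset.sum_range_succ, hmid, Nat.sub_self, Nat.sub_zero,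
    hℋ0, hℋ, hG0, hG, pow_add]
  simp only [Matrix.mul_assoc, Matrix.mul_neg, Matrix.mul_sub, Matrix.sub_mul, Matrix.one_mul]
  abel
end

section
/- Suppose the sequences x₂, x̂₂ : ℕ → ℝ^n, f, f̂ : ℕ → ℝ^{n_f}, and r, r̃, e : ℕ → ℝ^{n_y} satisfy, for all k: x₂(k+1) = Φx₂(k) + Ẽf(k); r(k+τ) = CΦ^τ x₂(k) + H f(k) + e(k+τ); f̂(k) = Π(r(k+τ) − CΦ^τ x̂₂(k)); r̃(k+τ) = r(k+τ) − CΦ^τ x̂₂(k) − H f̂(k); and x̂₂(k+1) = Φ x̂₂(k) + Ẽ f̂(k) + K_r r̃(k+τ). Then the estimation errors x̃(k) = x₂(k) − x̂₂(k) and f̃(k) = f(k) − f̂(k) satisfy, for all k: x̃(k+1) = (Φ₁ − K_r C₂) x̃(k) − (B₁ + K_r D₂) e(k+τ) and f̃(k) = C₁ x̃(k) − D₁ e(k+τ). -/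
/-- The error dynamics (equation (17)) of the system-inversion-based fault estimation
filter: the state estimation error `x̃ = x₂ − x̂₂` and fault estimation error
`f̃ = f − f̂` satisfy `x̃(k+1) = (Φ₁ − K_r C₂) x̃(k) − (B₁ + K_r D₂) e(k+τ)` and
`f̃(k) = C₁ x̃(k) − D₁ e(k+τ)`. -/
theorem stmt9 (n nf ny : ℕ) (τ : ℕ)
    (Φ : Matrix (Fin n) (Fin n) ℝ) (E : Matrix (Fin n) (Fin nf) ℝ)
    (C : Matrix (Fin ny) (Fin n) ℝ) (H : Matrix (Fin ny) (Fin nf) ℝ)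
    (Kr : Matrix (Fin n) (Fin ny) ℝ) (Pm : Matrix (Fin nf) (Fin ny) ℝ)
    (hPm : Pm * H = 1)
    (x₂ xh₂ : ℕ → Fin n → ℝ) (f fh : ℕ → Fin nf → ℝ) (r rt e : ℕ → Fin ny → ℝ)
    (hx₂ : ∀ k, x₂ (k + 1) = Φ.mulVec (x₂ k) + E.mulVec (f k))
    (hr : ∀ k, r (k + τ) = (C * Φ ^ τ).mulVec (x₂ k) + H.mulVec (f k) + e (k + τ))
    (hfh : ∀ k, fh k = Pm.mulVec (r (k + τ) - (C * Φ ^ τ).mulVec (xh₂ k)))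
    (hrt : ∀ k, rt (k + τ)
      = r (k + τ) - (C * Φ ^ τ).mulVec (xh₂ k) - H.mulVec (fh k))
    (hxh₂ : ∀ k, xh₂ (k + 1)
      = Φ.mulVec (xh₂ k) + E.mulVec (fh k) + Kr.mulVec (rt (k + τ))) :
    (∀ k, x₂ (k + 1) - xh₂ (k + 1)
        = ((Φ - E * Pm * C * Φ ^ τ)
            - Kr * (((1 : Matrix (Fin ny) (Fin ny) ℝ) - H * Pm) * C * Φ ^ τ)).mulVec
              (x₂ k - xh₂ k)
          - (E * Pm + Kr * ((1 : Matrix (Fin ny) (Fin ny) ℝ) - H * Pm)).mulVec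
              (e (k + τ)))
      ∧ (∀ k, f k - fh k
        = (-(Pm * C * Φ ^ τ)).mulVec (x₂ k - xh₂ k) - Pm.mulVec (e (k + τ))) := by
  have hf : ∀ k, f k - fh k
      = (-(Pm * C * Φ ^ τ)).mulVec (x₂ k - xh₂ k) - Pm.mulVec (e (k + τ)) := by
    intro k
    have hPH : Pm.mulVec (H.mulVec (f k)) = f k := by
      rw [Matrix.mulVec_mulVec, hPm, Matrix.one_mulVec]
    rw [hfh, hr]
    simp only [Matrix.mulVec_add, Matrix.mulVec_sub, Matrix.neg_mulVec, hPH,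
      ← Matrix.mulVec_mulVec]
    abel
  refine ⟨fun k => ?_, hf⟩
  have hdiff : x₂ (k + 1) - xh₂ (k + 1)
      = Φ.mulVec (x₂ k - xh₂ k) + E.mulVec (f k - fh k)
        - Kr.mulVec ((C * Φ ^ τ).mulVec (x₂ k - xh₂ k) + H.mulVec (f k - fh k)
          + e (k + τ)) := by
    rw [hx₂, hxh₂, hrt, hr]
    simp only [Matrix.mulVec_add, Matrix.mulVec_sub]
    abel
  rw [hdiff, hf]
  generalize x₂ k - xh₂ k = x
  simp only [Matrix.mulVec_add, Matrix.mulVec_sub, Matrix.add_mulVec, Matrix.sub_mulVec,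
    Matrix.neg_mulVec, Matrix.mulVec_neg, Matrix.one_mulVec, ← Matrix.mulVec_mulVec]
  abel
end

section
/- Let C ∈ ℂ^{n_y×n}, α ∈ ℂ^{s×n_y}, Π ∈ ℂ^{n_f×n_y} with s + n_f = n_y. If the n_y × n_y matrix obtained by stacking α on top of Π is invertible and ΠC = 0, then for every matrix A ∈ ℂ^{m×n}, the rank of the stacked matrix [[A],[αC]] equals the rank of the stacked matrix [[A],[C]]. -/
/-- Left multiplying the lower block of a stacked matrix does not increase its rank. -/
theorem Matrix.rank_fromRows_mul_le {R k l p q : Type*} [CommSemiring R] [StrongRankCondition R]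
    [Fintype k] [Fintype p] [Fintype q]
    (A : Matrix k q R) (X : Matrix l p R) (M : Matrix p q R) :
    (Matrix.fromRows A (X * M)).rank ≤ (Matrix.fromRows A M).rank := by
  classical
  have h : Matrix.fromRows A (X * M) =
      Matrix.fromBlocks (1 : Matrix k k R) 0 0 X * Matrix.fromRows A M := by
    simp [Matrix.fromBlocks_mul_fromRows]
  rw [h]
  exact Matrix.rank_mul_le_right _ _

/-- Rank identity used in the proof of Theorem 2: if the stacked matrix `[α; Π]` is
invertible and `ΠC = 0`, then for every matrix `A`, `rank [[A],[αC]] = rank [[A],[C]]`. -/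
theorem stmt14 (n ny s nf m : ℕ) (hdim : s + nf = ny)
    (C : Matrix (Fin ny) (Fin n) ℂ)
    (α : Matrix (Fin s) (Fin ny) ℂ) (Pm : Matrix (Fin nf) (Fin ny) ℂ)
    (hinv : ∃ B : Matrix (Fin ny) (Fin s ⊕ Fin nf) ℂ,
      Matrix.fromRows α Pm * B = 1 ∧ B * Matrix.fromRows α Pm = 1)
    (hPmC : Pm * C = 0) :
    ∀ A : Matrix (Fin m) (Fin n) ℂ,
      (Matrix.fromRows A (α * C)).rank = (Matrix.fromRows A C).rank := by
  intro A
  obtain ⟨B, -, hB⟩ := hinv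
  have hC : B.toCols₁ * (α * C) = C := by
    calc B.toCols₁ * (α * C)
        = Matrix.fromCols B.toCols₁ B.toCols₂ * Matrix.fromRows (α * C) (Pm * C) := by
          rw [Matrix.fromCols_mul_fromRows, hPmC, Matrix.mul_zero, add_zero]
      _ = C := by
          rw [Matrix.fromCols_toCols, ← Matrix.fromRows_mul, ← Matrix.mul_assoc, hB,
            Matrix.one_mul]
  refine le_antisymm (Matrix.rank_fromRows_mul_le A α C) ?_
  simpa only [hC] using Matrix.rank_fromRows_mul_le A B.toCols₁ (α * C)
end
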